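/- If there exists a secure equilibrium in a multiplayer quantitative reachability game (G, v₀), then there exists a secure equilibrium in (G, v₀) that is both goal-optimal and dev-optimal. -/

import Mathlib

open scoped Classical ENat

/-- A multiplayer quantitative reachability game: a finite directed graph whose
vertices are partitioned among the players (via `owner`), every vertex has an
outgoing edge, and each player `i` has a nonempty goal set `F i`. -/
structure QRGame (ι V : Type) where
  owner : V → ι
  E : V → V → Prop
  total : ∀ v, ∃ w, E v w
  F : ι → Set V
  F_ne : ∀ i, (F i).Nonempty

namespace QRGame

variable {ι V : Type}

/-- Histories are encoded as *reversed* nonempty lists: the head is the current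
vertex, the last element is the initial vertex `v₀`, and consecutive elements
are joined by edges of the graph. -/
def IsHist (G : QRGame ι V) (v₀ : V) : List V → Prop
  | [] => False
  | [v] => v = v₀
  | v :: w :: t => G.E w v ∧ IsHist G v₀ (w :: t)

/-- The current (i.e. most recent) vertex of a history. -/
def cur (v₀ : V) (h : List V) : V := h.headD v₀

/-- `σ` is a valid strategy of player `i`: on every history whose current
vertex belongs to player `i`, it chooses a successor along an edge. -/
def IsStrat (G : QRGame ι V) (v₀ : V) (i : ι) (σ : List V → V) : Prop :=
  ∀ h : List V, G.IsHist v₀ h → G.owner (cur v₀ h) = i → G.E (cur v₀ h) (σ h)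

/-- A strategy profile: one valid strategy for each player. -/
def IsProfile (G : QRGame ι V) (v₀ : V) (σ : ι → List V → V) : Prop :=
  ∀ i, G.IsStrat v₀ i (σ i)

/-- The history reached after `n` further steps when all players follow the
profile `σ` from the history `h` on. -/
def histFrom (G : QRGame ι V) (v₀ : V) (σ : ι → List V → V) (h : List V) : ℕ → List V
  | 0 => h
  | n + 1 =>
      σ (G.owner (cur v₀ (histFrom G v₀ σ h n))) (histFrom G v₀ σ h n)
        :: histFrom G v₀ σ h n

/-- The full play (indexed from time `0`) whose prefix is the history `h` and
which is consistent with the profile `σ` after `h`. -/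
def fullPlay (G : QRGame ι V) (v₀ : V) (σ : ι → List V → V) (h : List V) (t : ℕ) : V :=
  (G.histFrom v₀ σ h t).reverse.getD t v₀

/-- The outcome `⟨(σ_i)⟩_{v₀}` of the profile `σ` from the initial vertex. -/
def outcome (G : QRGame ι V) (v₀ : V) (σ : ι → List V → V) : ℕ → V :=
  G.fullPlay v₀ σ [v₀]

/-- Cost of player `i` for a play `ρ`: the least `l` with `ρ l ∈ F i`,
and `⊤` (i.e. `+∞`) if there is no such `l`. -/
noncomputable def cost (G : QRGame ι V) (i : ι) (ρ : ℕ → V) : ℕ∞ :=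
  ⨅ l ∈ {l : ℕ | ρ l ∈ G.F i}, (l : ℕ∞)

/-- Cost of player `i` for the finite prefix `ρ₀ … ρ_{m-1}` of a play. -/
noncomputable def costLT (G : QRGame ι V) (i : ι) (ρ : ℕ → V) (m : ℕ) : ℕ∞ :=
  ⨅ l ∈ {l : ℕ | l < m ∧ ρ l ∈ G.F i}, (l : ℕ∞)

end QRGame

/-- The preference relation `≺_j` of player `j` on cost profiles:
`x ≺_j y` iff `x j > y j`, or `x j = y j`, every player's cost does not
decrease, and some player's cost strictly increases. -/
def Prec {ι : Type} (j : ι) (x y : ι → ℕ∞) : Prop :=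
  y j < x j ∨ (x j = y j ∧ (∀ i, x i ≤ y i) ∧ ∃ i, x i < y i)

namespace QRGame

variable {ι V : Type} [DecidableEq ι]

/-- `σ` restricted after the history `h` is a secure equilibrium in the subgame
`(G|_h, cur h)`: no player `j` has a `≺_j`-profitable deviation after `h`
(costs are computed on the whole play, including the prefix `h`). -/
def IsSecureAfter (G : QRGame ι V) (v₀ : V) (σ : ι → List V → V) (h : List V) : Prop :=
  ¬ ∃ (j : ι) (σ' : List V → V), G.IsStrat v₀ j σ' ∧
      Prec j (fun i => G.cost i (G.fullPlay v₀ σ h))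
        (fun i => G.cost i (G.fullPlay v₀ (Function.update σ j σ') h))

/-- A secure equilibrium in `(G, v₀)`. -/
def IsSecure (G : QRGame ι V) (v₀ : V) (σ : ι → List V → V) : Prop :=
  G.IsSecureAfter v₀ σ [v₀]

/-- A subgame perfect secure equilibrium: a secure equilibrium in every subgame. -/
def IsSPSE (G : QRGame ι V) (v₀ : V) (σ : ι → List V → V) : Prop :=
  ∀ h : List V, G.IsHist v₀ h → G.IsSecureAfter v₀ σ h

end QRGame

namespace QRGame

variable {ι V : Type} [Fintype V]

/-- A strategy profile with outcome `ρ` is goal-optimal (with bound `Γ`) if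
every goal set visited by `ρ` is visited before depth `Γ`. -/
noncomputable def GoalOpt (G : QRGame ι V) (v₀ : V) (σ : ι → List V → V) (Γ : ℕ) : Prop :=
  ∀ i, G.cost i (G.outcome v₀ σ) ≠ ⊤ → G.cost i (G.outcome v₀ σ) < (Γ : ℕ∞)

/-- The bound `D = max{Cost_i(ρ) : Cost_i(ρ) < +∞} + |V|` attached to a play `ρ`. -/
noncomputable def devBound (G : QRGame ι V) (ρ : ℕ → V) : ℕ :=
  (⨆ i ∈ {i : ι | G.cost i ρ ≠ ⊤}, G.cost i ρ).toNat + Fintype.card V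

variable [DecidableEq ι]

/-- A secure equilibrium with outcome `ρ` is dev-optimal if for every player
`j` and deviation `σ'_j` (with resulting play `ρ'`), the cost profile of the
prefix `ρ_{<D}` is not `≺_j` the cost profile of the prefix `ρ'_{<D}`, where
`D = max{Cost_i(ρ) : Cost_i(ρ) < +∞} + |V|`. -/
noncomputable def DevOpt (G : QRGame ι V) (v₀ : V) (σ : ι → List V → V) : Prop :=
  ∀ (j : ι) (σ' : List V → V), G.IsStrat v₀ j σ' →
    ¬ Prec j
        (fun i => G.costLT i (G.outcome v₀ σ) (G.devBound (G.outcome v₀ σ)))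
        (fun i => G.costLT i (G.outcome v₀ (Function.update σ j σ'))
          (G.devBound (G.outcome v₀ σ)))

end QRGame

namespace QRGame

variable {ι V : Type}

/-- The history `y t, …, y 1, y 0` of a play, most recent vertex first. -/
def hist (y : ℕ → V) : ℕ → List V
  | 0 => [y 0]
  | t + 1 => y (t + 1) :: hist y t

@[simp] lemma length_hist (y : ℕ → V) (t : ℕ) : (hist y t).length = t + 1 := by
  induction t with
  | zero => rfl
  | succ t ih => simp [hist, ih]

@[simp] lemma cur_hist (v₀ : V) (y : ℕ → V) (t : ℕ) : cur v₀ (hist y t) = y t := by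
  cases t <;> rfl

lemma hist_congr {y z : ℕ → V} {t : ℕ} (h : ∀ s ≤ t, y s = z s) : hist y t = hist z t := by
  induction t with
  | zero => simp [hist, h 0 le_rfl]
  | succ t ih => simp [hist, h (t + 1) le_rfl, ih fun s hs => h s (by omega)]

lemma eq_of_hist_eq {y z : ℕ → V} {t : ℕ} (h : hist y t = hist z t) : ∀ s ≤ t, y s = z s := by
  induction t with
  | zero =>
    intro s hs
    obtain rfl : s = 0 := by omega
    simpa [hist] using h
  | succ t ih =>
    intro s hs
    simp only [hist, List.cons.injEq] at h
    rcases hs.eq_or_lt with rfl | hs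
    · exact h.1
    · exact ih h.2 s (by omega)

lemma drop_hist (y : ℕ → V) {s t : ℕ} (hs : s ≤ t) : (hist y t).drop (t - s) = hist y s := by
  induction t with
  | zero => simp [Nat.le_zero.1 hs]
  | succ t ih =>
    rcases hs.eq_or_lt with rfl | hs
    · simp
    · rw [Nat.succ_sub (by omega)]
      simpa [hist] using ih (by omega)

lemma isHist_hist (G : QRGame ι V) {y : ℕ → V} (t : ℕ)
    (h : ∀ s < t, G.E (y s) (y (s + 1))) : G.IsHist (y 0) (hist y t) := by
  induction t with
  | zero => simp [hist, IsHist]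
  | succ t ih =>
    have := ih fun s hs => h s (by omega)
    cases t with
    | zero => exact ⟨h 0 (by omega), this⟩
    | succ t => exact ⟨h _ (by omega), this⟩

section Outcome

variable (G : QRGame ι V) (v₀ : V) (σ : ι → List V → V)

lemma length_histFrom (t : ℕ) : (G.histFrom v₀ σ [v₀] t).length = t + 1 := by
  induction t with
  | zero => rfl
  | succ t ih => simp [histFrom, ih]

lemma outcome_eq_cur (t : ℕ) : G.outcome v₀ σ t = cur v₀ (G.histFrom v₀ σ [v₀] t) := by
  have h := G.length_histFrom v₀ σ t
  unfold outcome fullPlay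
  generalize G.histFrom v₀ σ [v₀] t = l at h
  cases l with
  | nil => simp at h
  | cons x l =>
    have : l.length = t := by simpa using h
    simp [cur, ← this]

@[simp] lemma outcome_zero : G.outcome v₀ σ 0 = v₀ := rfl

lemma histFrom_eq_hist (t : ℕ) : G.histFrom v₀ σ [v₀] t = hist (G.outcome v₀ σ) t := by
  induction t with
  | zero => rfl
  | succ t ih => rw [hist, outcome_eq_cur, ← ih]; rfl

lemma outcome_succ (t : ℕ) : G.outcome v₀ σ (t + 1) =
    σ (G.owner (G.outcome v₀ σ t)) (hist (G.outcome v₀ σ) t) := by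
  rw [outcome_eq_cur, outcome_eq_cur, ← histFrom_eq_hist]; rfl

lemma outcome_edge {σ : ι → List V → V} (hσ : G.IsProfile v₀ σ) (t : ℕ) :
    G.E (G.outcome v₀ σ t) (G.outcome v₀ σ (t + 1)) := by
  induction t using Nat.strong_induction_on with
  | _ t ih =>
    have h : G.IsHist v₀ (hist (G.outcome v₀ σ) t) := G.isHist_hist t ih
    have := hσ _ _ h rfl
    rwa [cur_hist, ← G.outcome_succ v₀ σ t] at this

end Outcome

section Cost

variable (G : QRGame ι V) {i : ι} {y z : ℕ → V}

lemma cost_le {t : ℕ} (h : y t ∈ G.F i) : G.cost i y ≤ t := iInf₂_le t h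

lemma exists_cost_eq (h : G.cost i y ≠ ⊤) : ∃ t : ℕ, G.cost i y = t ∧ y t ∈ G.F i := by
  have hex : ∃ t, y t ∈ G.F i := by
    by_contra! hn
    exact h (by simp [cost, hn])
  refine ⟨Nat.find hex, le_antisymm (G.cost_le (Nat.find_spec hex)) ?_, Nat.find_spec hex⟩
  exact le_iInf₂ fun t ht => by exact_mod_cast Nat.find_min' hex ht

lemma cost_eq_top_iff : G.cost i y = ⊤ ↔ ∀ t, y t ∉ G.F i := by
  constructor
  · intro h t ht
    have := G.cost_le ht
    simp [h] at this
  · intro h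
    simp [cost, h]

lemma cost_eq_of_agree {a : ℕ} (h : ∀ s ≤ a, y s = z s) (hy : G.cost i y ≤ a) :
    G.cost i z = G.cost i y := by
  obtain ⟨t, ht, hyt⟩ := G.exists_cost_eq (ne_top_of_le_ne_top (by simp) hy)
  have hta : t ≤ a := by exact_mod_cast ht ▸ hy
  have hz : G.cost i z ≤ t := G.cost_le (by rwa [← h t hta])
  obtain ⟨s, hs, hzs⟩ := G.exists_cost_eq (ne_top_of_le_ne_top (by simp) hz)
  have hst : s ≤ t := by exact_mod_cast hs ▸ hz
  refine le_antisymm (ht ▸ hz) (hs ▸ G.cost_le ?_)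
  rwa [h s (by omega)]

lemma costLT_eq (m : ℕ) : G.costLT i y m = if G.cost i y < m then G.cost i y else ⊤ := by
  split_ifs with h
  · obtain ⟨t, ht, hy⟩ := G.exists_cost_eq h.ne_top
    refine le_antisymm ?_ (le_iInf₂ fun s hs => G.cost_le hs.2)
    rw [ht] at h ⊢
    exact iInf₂_le t ⟨by exact_mod_cast h, hy⟩
  · refine iInf₂_eq_top.2 fun t ht => (h ?_).elim
    exact (G.cost_le ht.2).trans_lt (by exact_mod_cast ht.1)

end Cost

/-- The play in which every player moves according to the same map `f` from histories to
vertices. -/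
def run (G : QRGame ι V) (v₀ : V) (f : List V → V) : ℕ → V := G.outcome v₀ fun _ => f

/-- A play from `v₀` along the edges of `G` in which all players but `j` follow `f`. -/
structure IsDev (G : QRGame ι V) (v₀ : V) (f : List V → V) (j : ι) (y : ℕ → V) : Prop where
  zero : y 0 = v₀
  edge : ∀ t, G.E (y t) (y (t + 1))
  follow : ∀ t, G.owner (y t) ≠ j → y (t + 1) = f (hist y t)

/-- `f` moves along edges of `G`, after any list of vertices. -/
def IsLegal (G : QRGame ι V) (v₀ : V) (f : List V → V) : Prop :=
  ∀ h, G.E (cur v₀ h) (f h)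

section Transfer

variable {G : QRGame ι V} {v₀ : V} {f : List V → V} {j : ι} {y z : ℕ → V}

@[simp] lemma run_zero (G : QRGame ι V) (v₀ : V) (f : List V → V) : G.run v₀ f 0 = v₀ := rfl

lemma run_succ (G : QRGame ι V) (v₀ : V) (f : List V → V) (t : ℕ) :
    G.run v₀ f (t + 1) = f (hist (G.run v₀ f) t) :=
  G.outcome_succ v₀ (fun _ => f) t

lemma IsLegal.isProfile (hf : G.IsLegal v₀ f) : G.IsProfile v₀ fun _ => f :=
  fun _ h _ _ => hf h

lemma IsLegal.isDev_run (hf : G.IsLegal v₀ f) (j : ι) : G.IsDev v₀ f j (G.run v₀ f) where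
  zero := rfl
  edge := G.outcome_edge v₀ hf.isProfile
  follow t _ := G.run_succ v₀ f t

lemma run_unique (hz : y 0 = v₀) (hs : ∀ t, y (t + 1) = f (hist y t)) : G.run v₀ f = y := by
  funext t
  induction t using Nat.strong_induction_on with
  | _ t ih =>
    cases t with
    | zero => exact hz.symm
    | succ t => rw [run_succ, hs, hist_congr fun s hs => ih s (by omega)]

lemma isDev_outcome_update [DecidableEq ι] {σ : ι → List V → V} (hσ : G.IsProfile v₀ σ)
    {σ' : List V → V} (hσ' : G.IsStrat v₀ j σ') :
    G.IsDev v₀ (fun h => σ (G.owner (cur v₀ h)) h) j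
      (G.outcome v₀ (Function.update σ j σ')) where
  zero := rfl
  edge := by
    refine G.outcome_edge v₀ fun i => ?_
    rcases eq_or_ne i j with rfl | hi
    · simpa using hσ'
    · simpa [hi] using hσ i
  follow t ht := by
    rw [outcome_succ, Function.update_of_ne ht]
    simp

lemma IsLegal.isDev_outcome_update [DecidableEq ι] (hf : G.IsLegal v₀ f) {j : ι}
    {τ : List V → V} (hτ : G.IsStrat v₀ j τ) :
    G.IsDev v₀ f j (G.outcome v₀ (Function.update (fun _ => f) j τ)) :=
  QRGame.isDev_outcome_update hf.isProfile hτ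

/-- Every play that player `j` can enforce against `σ` is the outcome of a strategy of `j`. -/
lemma IsDev.exists_strat [DecidableEq ι] {σ : ι → List V → V}
    (hy : G.IsDev v₀ f j y)
    (hf : ∀ h, G.IsHist v₀ h → f h = σ (G.owner (cur v₀ h)) h) :
    ∃ σ', G.IsStrat v₀ j σ' ∧ G.outcome v₀ (Function.update σ j σ') = y := by
  choose c hc using G.total
  refine ⟨fun h => if h = hist y (h.length - 1) then y h.length else c (cur v₀ h), ?_, ?_⟩
  · intro h hh _
    dsimp only
    split_ifs with hl
    · have hpos : h.length ≠ 0 := by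
        rw [hl]; simp
      have := hy.edge (h.length - 1)
      rw [Nat.sub_add_cancel (by omega)] at this
      rwa [show cur v₀ h = y (h.length - 1) by rw [hl]; simp]
    · exact hc _
  · funext t
    induction t using Nat.strong_induction_on with
    | _ t ih =>
      cases t with
      | zero => exact hy.zero.symm
      | succ t =>
        rw [outcome_succ, hist_congr (fun s hs => ih s (by omega)), ih t (by omega)]
        rcases eq_or_ne (G.owner (y t)) j with hj | hj
        · simp [hj]
        · rw [Function.update_of_ne hj, hy.follow t hj, hf, cur_hist]
          have := G.isHist_hist t fun s _ => hy.edge s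
          rwa [hy.zero] at this

/-- A partial play in which all players but `j` follow `f` can be prolonged by any positional
behaviour of `j`. -/
lemma IsLegal.exists_isDev (hf : G.IsLegal v₀ f) {c : V → V} (hc : ∀ v, G.E v (c v)) {t : ℕ}
    (hz : y 0 = v₀) (he : ∀ s < t, G.E (y s) (y (s + 1)))
    (hs : ∀ s < t, G.owner (y s) ≠ j → y (s + 1) = f (hist y s)) :
    ∃ z, G.IsDev v₀ f j z ∧ (∀ s ≤ t, y s = z s) ∧
      ∀ s ≥ t, G.owner (z s) = j → z (s + 1) = c (z s) := by
  set F : List V → V := fun h =>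
    if h.length ≤ t then y h.length
    else if G.owner (cur v₀ h) = j then c (cur v₀ h) else f h with hF
  set z := G.run v₀ F with hzdef
  have hlt : ∀ s < t, z (s + 1) = y (s + 1) := fun s hst => by
    rw [hzdef, run_succ]
    simp only [hF, length_hist]
    rw [if_pos (by omega)]
  have hge : ∀ s ≥ t, z (s + 1) = if G.owner (z s) = j then c (z s) else f (hist z s) :=
    fun s hst => by
      rw [hzdef, run_succ, ← hzdef]
      simp only [hF, length_hist, cur_hist]
      rw [if_neg (by omega)]
  have hagree : ∀ s ≤ t, y s = z s := by
    intro s hst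
    cases s with
    | zero => exact hz
    | succ s => exact (hlt s hst).symm
  refine ⟨z, ⟨rfl, fun s => ?_, fun s hj => ?_⟩, hagree, fun s hst hj => ?_⟩
  · rcases lt_or_ge s t with hst | hst
    · rw [← hagree s hst.le, ← hagree (s + 1) hst]
      exact he s hst
    · rw [hge s hst]
      split_ifs
      · exact hc _
      · simpa using hf (hist z s)
  · rcases lt_or_ge s t with hst | hst
    · rw [← hagree (s + 1) hst, hs s hst (by rwa [hagree s hst.le]),
        hist_congr fun r hr => hagree r (by omega)]
    · rw [hge s hst, if_neg hj]
  · rw [hge s hst, if_pos hj]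

/-- A play that leaves the outcome of `f` does so at a vertex of the deviating player. -/
lemma IsDev.owner_eq (hy : G.IsDev v₀ f j y) {s : ℕ} (h : ∀ r ≤ s, y r = G.run v₀ f r)
    (hs : y (s + 1) ≠ G.run v₀ f (s + 1)) : G.owner (y s) = j := by
  by_contra hj
  exact hs (by rw [hy.follow s hj, run_succ, hist_congr h])

lemma IsDev.unique_player {j' : ι} (hy : G.IsDev v₀ f j y) (hz : G.IsDev v₀ f j' z) {a : ℕ}
    (hyz : hist y a = hist z a) (hne : hist y a ≠ hist (G.run v₀ f) a) : j = j' := by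
  have hex : ∃ t, t ≤ a ∧ y t ≠ G.run v₀ f t := by
    by_contra! hn
    exact hne (hist_congr hn)
  have hyz' := eq_of_hist_eq hyz
  obtain ⟨hta, ht⟩ := Nat.find_spec hex
  have hmin : ∀ r < Nat.find hex, y r = G.run v₀ f r := fun r hr => by
    by_contra hn
    exact Nat.find_min hex hr ⟨by omega, hn⟩
  generalize Nat.find hex = t at hta ht hmin
  cases t with
  | zero => exact (ht hy.zero).elim
  | succ s =>
    rw [← hy.owner_eq (fun r hr => hmin r (by omega)) ht, hyz' s (by omega)]
    refine hz.owner_eq (fun r hr => ?_) ?_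
    · rw [← hyz' r (by omega)]; exact hmin r (by omega)
    · rwa [← hyz' (s + 1) hta]

end Transfer

section Attractor

variable (G : QRGame ι V) (j : ι) (B U : Set V)

/-- The vertices from which the opponents of `j` can force the next vertex to lie in `X`. -/
def pre (X : Set V) : Set V :=
  {v | (G.owner v = j → ∀ w, G.E v w → w ∈ X) ∧ (G.owner v ≠ j → ∃ w, G.E v w ∧ w ∈ X)}

/-- The vertices from which the opponents of `j` can avoid `B` forever. -/
def safe : Set V := ⋃₀ {S | Disjoint S B ∧ S ⊆ G.pre j S}

/-- The vertices from which the opponents of `j` can reach `U` in fewer than `m` steps while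
avoiding `B` forever. -/
def attr : ℕ → Set V
  | 0 => ∅
  | m + 1 => {v ∈ G.safe j B | v ∈ U ∨ v ∈ G.pre j (attr m)}

variable {G j B U}

lemma pre_mono {X Y : Set V} (h : X ⊆ Y) : G.pre j X ⊆ G.pre j Y :=
  fun _ hv => ⟨fun hj w hw => h (hv.1 hj w hw), fun hj => (hv.2 hj).imp fun _ hw => ⟨hw.1, h hw.2⟩⟩

lemma safe_subset_pre : G.safe j B ⊆ G.pre j (G.safe j B) := by
  rintro v ⟨S, hS, hv⟩
  exact pre_mono (Set.subset_sUnion_of_mem hS) (hS.2 hv)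

lemma notMem_of_mem_safe {v : V} (hv : v ∈ G.safe j B) : v ∉ B := by
  obtain ⟨S, hS, hv⟩ := hv
  exact hS.1.notMem_of_mem_left hv

lemma attr_subset_safe (m : ℕ) : G.attr j B U m ⊆ G.safe j B := by
  cases m with
  | zero => exact Set.empty_subset _
  | succ m => exact fun v hv => hv.1

lemma attr_mono : Monotone (G.attr j B U) := by
  refine monotone_nat_of_le_succ fun m => ?_
  induction m with
  | zero => exact Set.empty_subset _
  | succ m ih => exact fun v hv => ⟨hv.1, hv.2.imp_right fun h => pre_mono ih h⟩

lemma attr_card_succ [Fintype V] :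
    G.attr j B U (Fintype.card V + 1) = G.attr j B U (Fintype.card V) := by
  have hset : ∀ m, (G.attr j B U m).ncard = (G.attr j B U (m + 1)).ncard →
      G.attr j B U m = G.attr j B U (m + 1) := fun m h =>
    Set.eq_of_subset_of_ncard_le (attr_mono m.le_succ) h.ge
  refine (hset _ (Eq.symm ?_)).symm
  refine Nat.stabilises_of_monotone (f := fun m => (G.attr j B U m).ncard)
    (fun m k h => Set.ncard_le_ncard (attr_mono h)) (fun m => ?_) (fun m h => ?_)
    (Nat.le_succ _)
  · simpa using Set.ncard_le_card (G.attr j B U m)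
  · exact congrArg (fun X => {v ∈ G.safe j B | v ∈ U ∨ v ∈ G.pre j X}.ncard) (hset m h)

variable (G j B U) in
/-- A positional strategy of the opponents of `j` realising `attr`. -/
lemma exists_positional : ∃ g : V → V, ∀ v, G.E v (g v) ∧ (G.owner v ≠ j →
    (v ∈ G.safe j B → g v ∈ G.safe j B) ∧
    ∀ m, v ∈ G.attr j B U (m + 1) → v ∉ U → g v ∈ G.attr j B U m) := by
  suffices ∀ v, ∃ w, G.E v w ∧ (G.owner v ≠ j → (v ∈ G.safe j B → w ∈ G.safe j B) ∧
      ∀ m, v ∈ G.attr j B U (m + 1) → v ∉ U → w ∈ G.attr j B U m) by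
    choose g hg using this
    exact ⟨g, hg⟩
  intro v
  obtain ⟨w₀, hw₀⟩ := G.total v
  by_cases hj : G.owner v = j
  · exact ⟨w₀, hw₀, fun h => (h hj).elim⟩
  by_cases hex : ∃ m, v ∈ G.attr j B U (m + 1) ∧ v ∉ U
  · obtain ⟨hv, hU⟩ := Nat.find_spec hex
    obtain ⟨w, hw, hwm⟩ := (hv.2.resolve_left hU).2 hj
    refine ⟨w, hw, fun _ => ⟨fun _ => attr_subset_safe _ hwm, fun m hm hU => ?_⟩⟩
    exact attr_mono (Nat.find_min' hex ⟨hm, hU⟩) hwm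
  · by_cases hv : v ∈ G.safe j B
    · obtain ⟨w, hw, hws⟩ := (safe_subset_pre hv).2 hj
      exact ⟨w, hw, fun _ => ⟨fun _ => hws, fun m hm hU => (hex ⟨m, hm, hU⟩).elim⟩⟩
    · exact ⟨w₀, hw₀, fun _ => ⟨fun h => (hv h).elim, fun m hm hU => (hex ⟨m, hm, hU⟩).elim⟩⟩

lemma safe_of_positional {g : V → V} (hg : ∀ v, G.E v (g v) ∧ (G.owner v ≠ j →
    (v ∈ G.safe j B → g v ∈ G.safe j B) ∧
    ∀ m, v ∈ G.attr j B U (m + 1) → v ∉ U → g v ∈ G.attr j B U m))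
    {z : ℕ → V} {a : ℕ} (he : ∀ t ≥ a, G.E (z t) (z (t + 1)))
    (hs : ∀ t ≥ a, G.owner (z t) ≠ j → z (t + 1) = g (z t))
    (h0 : z a ∈ G.safe j B) : ∀ t ≥ a, z t ∈ G.safe j B := by
  intro t ht
  induction t, ht using Nat.le_induction with
  | base => exact h0
  | succ t ht ih =>
    by_cases hj : G.owner (z t) = j
    · exact (safe_subset_pre ih).1 hj _ (he t ht)
    · rw [hs t ht hj]
      exact ((hg _).2 hj).1 ih

lemma reach_of_positional {g : V → V} (hg : ∀ v, G.E v (g v) ∧ (G.owner v ≠ j →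
    (v ∈ G.safe j B → g v ∈ G.safe j B) ∧
    ∀ m, v ∈ G.attr j B U (m + 1) → v ∉ U → g v ∈ G.attr j B U m))
    {z : ℕ → V} {a : ℕ} (he : ∀ t ≥ a, G.E (z t) (z (t + 1)))
    (hs : ∀ t ≥ a, G.owner (z t) ≠ j → z (t + 1) = g (z t))
    {m : ℕ} (h0 : z a ∈ G.attr j B U m) :
    ∃ t ≥ a, t < a + m ∧ z t ∈ U := by
  induction m generalizing a with
  | zero => exact h0.elim
  | succ m ih =>
    by_cases hU : z a ∈ U
    · exact ⟨a, le_rfl, by omega, hU⟩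
    · have h1 : z (a + 1) ∈ G.attr j B U m := by
        by_cases hj : G.owner (z a) = j
        · exact (h0.2.resolve_left hU).1 hj _ (he a le_rfl)
        · rw [hs a le_rfl hj]
          exact ((hg _).2 hj).2 m h0 hU
      obtain ⟨t, ht, htm, htU⟩ := ih (fun t ht => he t (by omega)) (fun t ht => hs t (by omega)) h1
      exact ⟨t, by omega, by omega, htU⟩

/-- If `f` lets the opponents of `j` reach `U` and avoid `B` after the prefix `y 0, …, y a`, then
`y a` lies in the attractor. -/
lemma mem_attr_of_forall_isDev [Fintype V] {v₀ : V} {f : List V → V} (hf : G.IsLegal v₀ f)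
    {y : ℕ → V} (hy : G.IsDev v₀ f j y) {a : ℕ}
    (hB : ∀ z, G.IsDev v₀ f j z → (∀ s ≤ a, y s = z s) → ∀ t ≥ a, z t ∉ B)
    (hU : ∀ z, G.IsDev v₀ f j z → (∀ s ≤ a, y s = z s) → ∃ t ≥ a, z t ∈ U) :
    y a ∈ G.attr j B U (Fintype.card V) := by
  choose c₀ hc₀ using G.total
  let S : Set V := {v | ∃ z, G.IsDev v₀ f j z ∧ (∀ s ≤ a, y s = z s) ∧ ∃ t ≥ a, z t = v}
  have hS : S ⊆ G.safe j B := by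
    refine Set.subset_sUnion_of_mem ⟨Set.disjoint_left.2 ?_, ?_⟩
    · rintro _ ⟨z, hz, hyz, t, ht, rfl⟩
      exact hB z hz hyz t ht
    · rintro _ ⟨z, hz, hyz, t, ht, rfl⟩
      refine ⟨fun hj w hw => ?_, fun hj => ⟨_, hz.edge t, z, hz, hyz, t + 1, by omega, rfl⟩⟩
      obtain ⟨z', hz', hzz', hc⟩ := hf.exists_isDev (j := j) (c := Function.update c₀ (z t) w)
        (fun v => by
          rcases eq_or_ne v (z t) with rfl | hv
          · simpa using hw
          · simpa [hv] using hc₀ v)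
        (t := t) hz.zero (fun s _ => hz.edge s) (fun s _ => hz.follow s)
      refine ⟨z', hz', fun s hs => (hyz s hs).trans (hzz' s (by omega)), t + 1, by omega, ?_⟩
      rw [hc t le_rfl (by rwa [← hzz' t le_rfl]), ← hzz' t le_rfl, Function.update_self]
  by_contra hya
  set A := G.attr j B U (Fintype.card V) with hA
  have hstep : ∀ v ∈ G.safe j B, v ∉ A → v ∉ U ∧ v ∉ G.pre j A := fun v hv hvA => by
    rw [hA, ← attr_card_succ] at hvA
    exact ⟨fun h => hvA ⟨hv, .inl h⟩, fun h => hvA ⟨hv, .inr h⟩⟩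
  have hc : ∀ v, ∃ w, G.E v w ∧ ((∃ w, G.E v w ∧ w ∉ A) → w ∉ A) := fun v => by
    by_cases h : ∃ w, G.E v w ∧ w ∉ A
    · exact h.imp fun w hw => ⟨hw.1, fun _ => hw.2⟩
    · exact ⟨c₀ v, hc₀ v, fun h' => (h h').elim⟩
  choose c hcE hcA using hc
  obtain ⟨z, hz, hyz, hcz⟩ := hf.exists_isDev (j := j) hcE (t := a) hy.zero
    (fun s _ => hy.edge s) (fun s _ => hy.follow s)
  have hsafe : ∀ t ≥ a, z t ∈ G.safe j B := fun t ht => hS ⟨z, hz, hyz, t, ht, rfl⟩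
  have hout : ∀ t ≥ a, z t ∉ A := by
    intro t ht
    induction t, ht using Nat.le_induction with
    | base => rwa [← hyz a le_rfl]
    | succ t ht ih =>
      have hp := (hstep _ (hsafe t ht) ih).2
      by_cases hj : G.owner (z t) = j
      · rw [hcz t ht hj]
        refine hcA _ ?_
        by_contra! hn
        exact hp ⟨fun _ => hn, fun h => (h hj).elim⟩
      · exact fun h => hp ⟨fun h' => (hj h').elim, fun _ => ⟨_, hz.edge t, h⟩⟩
  obtain ⟨t, ht, htU⟩ := hU z hz hyz
  exact (hstep _ (hsafe t ht) (hout t ht)).1 htU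

end Attractor

/-- No player has a profitable deviation from the profile in which everybody follows `f`. -/
def IsStable (G : QRGame ι V) (v₀ : V) (f : List V → V) : Prop :=
  ∀ j y, G.IsDev v₀ f j y → ¬ Prec j (fun i => G.cost i (G.run v₀ f)) fun i => G.cost i y

/-- A secure equilibrium gives rise to a legal stable map. -/
lemma IsSecure.exists_isStable [DecidableEq ι] {G : QRGame ι V} {v₀ : V}
    {σ : ι → List V → V} (hσ : G.IsProfile v₀ σ)
    (hs : G.IsSecure v₀ σ) : ∃ f, G.IsLegal v₀ f ∧ G.IsStable v₀ f := by
  choose c hc using G.total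
  let f : List V → V := fun h =>
    if G.E (cur v₀ h) (σ (G.owner (cur v₀ h)) h) then σ (G.owner (cur v₀ h)) h else c (cur v₀ h)
  have hf : ∀ h, G.IsHist v₀ h → f h = σ (G.owner (cur v₀ h)) h := fun h hh =>
    if_pos (hσ _ h hh rfl)
  have hlegal : G.IsLegal v₀ f := fun h => by
    dsimp only [f]
    split_ifs with H
    · exact H
    · exact hc _
  have hrun : G.run v₀ f = G.outcome v₀ σ := by
    refine run_unique rfl fun t => ?_
    rw [hf _ (G.isHist_hist t fun s _ => G.outcome_edge v₀ hσ s), cur_hist, outcome_succ]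
  refine ⟨f, hlegal, fun j y hy hp => ?_⟩
  obtain ⟨σ', hσ', hout⟩ := hy.exists_strat hf
  refine hs ⟨j, σ', hσ', ?_⟩
  rw [hrun, ← hout] at hp
  exact hp

section Fast

variable [Fintype V] {G : QRGame ι V} {v₀ : V} {f : List V → V}

/-- If no goal set is visited for the first time between `a` and `a + |V|`, then all players
deviating before time `a` can be punished before time `a + |V|`. -/
lemma exists_fast_punishment (hf : G.IsLegal v₀ f) (hs : G.IsStable v₀ f) {a : ℕ}
    (ha : ∀ i, G.cost i (G.run v₀ f) ≤ a ∨
      ((a + Fintype.card V : ℕ) : ℕ∞) ≤ G.cost i (G.run v₀ f)) :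
    ∃ f', G.IsLegal v₀ f' ∧ G.run v₀ f' = G.run v₀ f ∧ G.IsStable v₀ f' ∧
      ∀ j y, G.IsDev v₀ f' j y → hist y a ≠ hist (G.run v₀ f) a →
        (G.cost j (G.run v₀ f) ≤ a ∨ G.cost j (G.run v₀ f) = ⊤) →
        (∃ i, G.cost i y < G.cost i (G.run v₀ f) ∧
          G.cost i y < ((a + Fintype.card V : ℕ) : ℕ∞)) ∨
        G.cost j (G.run v₀ f) < G.cost j y ∨
        (∀ i, G.cost i (G.run v₀ f) ≤ a → G.cost i y = G.cost i (G.run v₀ f)) ∧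
          ∀ i, G.cost i (G.run v₀ f) ≤ a ∨ G.cost i (G.run v₀ f) = ⊤ := by
  set ρ := G.run v₀ f with hρ
  set n := Fintype.card V
  have hn : 0 < n := Fintype.card_pos_iff.2 ⟨v₀⟩
  let B : ι → Set V := fun j => {v | G.cost j ρ = ⊤ ∧ v ∈ G.F j}
  let U : Set V := {v | ∃ i, (a : ℕ∞) < G.cost i ρ ∧ v ∈ G.F i}
  choose g hg using fun j => exists_positional G j (B j) U
  let C : ι → List V → Prop := fun j h => (G.cost j ρ ≤ a ∨ G.cost j ρ = ⊤) ∧ h ≠ hist ρ a ∧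
    ∃ y, G.IsDev v₀ f j y ∧ hist y a = h ∧ y a ∈ G.attr j (B j) U n
  let f' : List V → V := fun h =>
    if H : ∃ j, C j (h.drop (h.length - (a + 1))) then g H.choose (cur v₀ h) else f h
  have hlegal : G.IsLegal v₀ f' := fun h => by
    dsimp only [f']
    split_ifs with H
    · exact (hg _ _).1
    · exact hf h
  have hno : ∀ (y : ℕ → V) (t : ℕ), (t < a ∨ ¬ ∃ j, C j (hist y a)) →
      f' (hist y t) = f (hist y t) := by
    intro y t ht
    refine dif_neg ?_
    rintro ⟨j, hC⟩
    simp only [length_hist, Nat.add_sub_add_right] at hC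
    rcases lt_or_ge t a with hta | hta
    · rw [Nat.sub_eq_zero_of_le hta.le] at hC
      obtain ⟨-, -, z, -, hz, -⟩ := hC
      have := congrArg List.length hz
      simp at this
      omega
    · rw [drop_hist y hta] at hC
      exact ht.elim (fun h => by omega) fun h => h ⟨j, hC⟩
  have hrun : G.run v₀ f' = ρ := by
    refine run_unique rfl fun t => ?_
    rw [hno ρ t (.inr ?_)]
    · exact G.run_succ v₀ f t
    · rintro ⟨j, -, hne, -⟩
      exact hne rfl
  have key : ∀ j y, G.IsDev v₀ f' j y →
      (G.IsDev v₀ f j y ∧ ¬ C j (hist y a)) ∨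
      (G.cost j ρ ≤ G.cost j y ∧ ∃ i, G.cost i y < G.cost i ρ ∧
          G.cost i y < ((a + n : ℕ) : ℕ∞)) := by
    intro j y hy
    by_cases H : ∃ j, C j (hist y a)
    · right
      have hj : H.choose = j := by
        obtain ⟨-, hne, z, hz, hzy, -⟩ := H.choose_spec
        choose c hc using G.total
        obtain ⟨w, hw, hyw, -⟩ := hf.exists_isDev (j := j) hc (t := a) hy.zero
          (fun s _ => hy.edge s) (fun s hs hj => by rw [hy.follow s hj, hno y s (.inl hs)])
        rw [← hzy] at hne
        exact hz.unique_player hw (hzy.trans (hist_congr hyw)) hne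
      have hspec := H.choose_spec
      rw [hj] at hspec
      obtain ⟨hxj, -, z, hz, hzy, hza⟩ := hspec
      have hag := eq_of_hist_eq hzy
      rw [hag a le_rfl] at hza
      have hfol : ∀ t ≥ a, G.owner (y t) ≠ j → y (t + 1) = g j (y t) := fun t ht hjt => by
        have hd : (hist y t).drop ((hist y t).length - (a + 1)) = hist y a := by
          simpa using drop_hist y ht
        rw [hy.follow t hjt]
        dsimp only [f']
        simp only [hd]
        rw [dif_pos H, hj, cur_hist]
      have hsafe := safe_of_positional (hg j) (fun t _ => hy.edge t) hfol (attr_subset_safe _ hza)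
      obtain ⟨t, -, hta, i, hi, hti⟩ :=
        reach_of_positional (hg j) (fun t _ => hy.edge t) hfol hza
      have hzj : G.cost j ρ ≤ G.cost j z := not_lt.1 fun h => hs j z hz (.inl h)
      refine ⟨?_, i, ?_⟩
      · rcases hxj with hxj | hxj
        · by_contra! hlt
          rw [G.cost_eq_of_agree (fun s hs => (hag s hs).symm) (hlt.le.trans hxj)] at hzj
          exact hzj.not_gt hlt
        · rw [hxj, top_le_iff, cost_eq_top_iff] at hzj ⊢
          intro s
          rcases le_total s a with hsa | hsa
          · rw [← hag s hsa]; exact hzj s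
          · exact fun h => notMem_of_mem_safe (hsafe s hsa) ⟨hxj, h⟩
      · have h1 : G.cost i y < ((a + n : ℕ) : ℕ∞) :=
          (G.cost_le hti).trans_lt (by exact_mod_cast hta)
        exact ⟨h1.trans_le ((ha i).resolve_left hi.not_ge), h1⟩
    · exact .inl ⟨⟨hy.zero, hy.edge, fun t ht => by rw [hy.follow t ht, hno y t (.inr H)]⟩,
        fun h => H ⟨j, h⟩⟩
  refine ⟨f', hlegal, hrun, fun j y hy hp => ?_, fun j y hy hne hxj => ?_⟩
  · rw [hrun] at hp
    rcases key j y hy with h | ⟨hle, i, hi, -⟩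
    · exact hs j y h.1 hp
    · rcases hp with hp | ⟨-, hp, -⟩
      · exact hle.not_gt hp
      · exact (hp i).not_gt hi
  · rcases key j y hy with ⟨hy, hC⟩ | ⟨-, h⟩
    swap
    · exact .inl h
    by_contra! hcon
    obtain ⟨h1, h2, h3⟩ := hcon
    have hge : ∀ z, G.IsDev v₀ f j z → G.cost j ρ ≤ G.cost j z := fun z hz =>
      not_lt.1 fun h => hs j z hz (.inl h)
    have hyj : G.cost j y = G.cost j ρ := le_antisymm h2 (hge y hy)
    refine hC ⟨hxj, hne, y, hy, rfl, mem_attr_of_forall_isDev hf hy ?_ ?_⟩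
    · rintro z hz - t - ⟨htop, ht⟩
      have := hge z hz
      rw [htop, top_le_iff, cost_eq_top_iff] at this
      exact this t ht
    · intro z hz hyz
      have hzj : G.cost j ρ = G.cost j z := by
        rcases hxj with hxj | hxj
        · rw [G.cost_eq_of_agree hyz (hyj ▸ hxj), hyj]
        · have := hge z hz
          rw [hxj, top_le_iff] at this
          rw [hxj, this]
      have hvisit : ∀ i, G.cost i z ≠ ⊤ → (a : ℕ∞) < G.cost i z → (a : ℕ∞) < G.cost i ρ →
          ∃ t ≥ a, z t ∈ U := fun i hi hz hx => by
        obtain ⟨t, ht, hti⟩ := G.exists_cost_eq hi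
        rw [ht] at hz
        exact ⟨t, by exact_mod_cast hz.le, i, hx, hti⟩
      by_cases hlt : ∃ i, G.cost i z < G.cost i ρ
      · obtain ⟨i, hi⟩ := hlt
        have haz : (a : ℕ∞) < G.cost i z := by
          by_contra! haz
          have hyi := G.cost_eq_of_agree (fun s hs => (hyz s hs).symm) haz
          have := (h1 i (hyi ▸ hi)).trans (hyi.le.trans haz)
          norm_cast at this
          omega
        exact hvisit i hi.ne_top haz (haz.trans hi)
      · push Not at hlt
        have heq : ∀ i, G.cost i z = G.cost i ρ := fun i => by
          by_contra hi
          exact hs j z hz (.inr ⟨hzj, hlt, i, lt_of_le_of_ne (hlt i) (Ne.symm hi)⟩)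
        obtain ⟨i, hi, hi'⟩ := h3 fun i hi => by
          rw [G.cost_eq_of_agree (fun s hs => (hyz s hs).symm) (heq i ▸ hi), heq]
        exact hvisit i (heq i ▸ hi') (heq i ▸ hi) hi

end Fast

section Cut

/-- Shift all dates after `a` by `d`. -/
noncomputable def shiftAfter (a d : ℕ) (c : ℕ∞) : ℕ∞ := if c ≤ a then c else c + d

lemma shiftAfter_strictMono (a d : ℕ) : StrictMono (shiftAfter a d) := by
  intro c c' h
  unfold shiftAfter
  split_ifs with h1 h2 h2
  · exact h
  · exact h.trans_le le_self_add
  · exact (h1 (h.le.trans h2)).elim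
  · exact (ENat.add_lt_add_iff_right (ENat.natCast_ne_top d)).2 h

lemma prec_comp_iff {φ : ℕ∞ → ℕ∞} (hφ : StrictMono φ) {j : ι} {x y : ι → ℕ∞} :
    Prec j (fun i => φ (x i)) (fun i => φ (y i)) ↔ Prec j x y := by
  simp only [Prec, hφ.lt_iff_lt, hφ.le_iff_le, hφ.injective.eq_iff]

/-- The play `ρ` up to time `b`, followed by what `y` does after time `b - d`. -/
def splice (ρ : ℕ → V) (b d : ℕ) (y : ℕ → V) (t : ℕ) : V := if t ≤ b then ρ t else y (t - d)

variable {ρ y : ℕ → V} {a d : ℕ}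

lemma splice_of_le {b t : ℕ} (h : t ≤ b) : splice ρ b d y t = ρ t := if_pos h

lemma splice_add (hρ : ρ a = ρ (a + d)) (hy : ∀ s ≤ a, y s = ρ s) {t : ℕ} (ht : a ≤ t) :
    splice ρ (a + d) d y (t + d) = y t := by
  unfold splice
  split_ifs with h
  · obtain rfl : t = a := by omega
    rw [← hρ, hy t le_rfl]
  · simp

lemma hist_splice (hρ : ρ a = ρ (a + d)) (hy : ∀ s ≤ a, y s = ρ s) {t : ℕ} (ht : a ≤ t) :
    (hist y t).take (t - a) ++ hist ρ (a + d) = hist (splice ρ (a + d) d y) (t + d) := by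
  induction t, ht using Nat.le_induction with
  | base =>
    simp only [Nat.sub_self, List.take_zero, List.nil_append]
    exact hist_congr fun s hs => (splice_of_le hs).symm
  | succ t ht ih =>
    rw [Nat.succ_sub ht, show t + 1 + d = t + d + 1 by omega, hist, hist, List.take_succ_cons,
      List.cons_append, ih, show t + d + 1 = t + 1 + d by omega, splice_add hρ hy (by omega)]

lemma cost_splice (G : QRGame ι V) (hρ : ρ a = ρ (a + d)) (hy : ∀ s ≤ a, y s = ρ s) {i : ι}
    (hi : G.cost i ρ ≤ a ∨ ((a + d : ℕ) : ℕ∞) < G.cost i ρ) :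
    G.cost i (splice ρ (a + d) d y) = shiftAfter a d (G.cost i y) := by
  unfold shiftAfter
  split_ifs with h
  · exact G.cost_eq_of_agree (fun s hs => by rw [splice_of_le (by omega), hy s hs]) h
  · have hno : ∀ t ≤ a + d, ρ t ∉ G.F i := fun t ht hti => by
      rcases hi with hi | hi
      · exact h ((G.cost_eq_of_agree (fun s hs => (hy s hs).symm) hi).trans_le hi)
      · exact ((G.cost_le hti).trans (by exact_mod_cast ht)).not_gt hi
    refine le_antisymm ?_ (le_iInf₂ fun t ht => ?_)
    · by_cases htop : G.cost i y = ⊤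
      · simp [htop]
      · obtain ⟨t, ht, hti⟩ := G.exists_cost_eq htop
        rw [ht] at h ⊢
        have hat : a ≤ t := by
          norm_cast at h
          omega
        rw [← splice_add hρ hy hat] at hti
        exact_mod_cast G.cost_le hti
    · have hat : a + d < t := by
        by_contra! hn
        rw [Set.mem_ofPred_eq, splice_of_le hn] at ht
        exact hno t hn ht
      obtain ⟨s, rfl⟩ : ∃ s, t = s + d := ⟨t - d, by omega⟩
      rw [Set.mem_ofPred_eq, splice_add hρ hy (by omega)] at ht
      push_cast
      gcongr
      exact G.cost_le ht

variable [Fintype V] {G : QRGame ι V} {v₀ : V} {f : List V → V}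

/-- A cycle of the outcome during which, and in the `|V|` steps after which, no goal set is visited
for the first time can be removed if some goal set is visited later on. -/
lemma exists_cut (hf : G.IsLegal v₀ f) (hs : G.IsStable v₀ f) (hd : 0 < d)
    (hρ : G.run v₀ f a = G.run v₀ f (a + d))
    (hx : ∀ i, G.cost i (G.run v₀ f) ≤ a ∨
      ((a + d + Fintype.card V : ℕ) : ℕ∞) ≤ G.cost i (G.run v₀ f))
    (hfin : ∃ i, ¬ (G.cost i (G.run v₀ f) ≤ a) ∧ G.cost i (G.run v₀ f) ≠ ⊤) :
    ∃ f', G.IsLegal v₀ f' ∧ G.IsStable v₀ f' ∧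
      ∀ i, G.cost i (G.run v₀ f) = shiftAfter a d (G.cost i (G.run v₀ f')) := by
  have hn : 0 < Fintype.card V := Fintype.card_pos_iff.2 ⟨v₀⟩
  obtain ⟨f₁, hf₁, hrun, hs₁, hfast⟩ := exists_fast_punishment hf hs (a := a) fun i =>
    (hx i).imp_right fun h => le_trans (by exact_mod_cast (by omega)) h
  set ρ := G.run v₀ f
  let f' : List V → V := fun h =>
    if h.drop (h.length - (a + 1)) = hist ρ a
    then f₁ (h.take (h.length - (a + 1)) ++ hist ρ (a + d)) else f₁ h
  have hlegal : G.IsLegal v₀ f' := fun h => by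
    dsimp only [f']
    split_ifs with H
    · have hcur : cur v₀ h = cur v₀ (h.take (h.length - (a + 1)) ++ hist ρ (a + d)) := by
        conv_lhs => rw [← List.take_append_drop (h.length - (a + 1)) h, H]
        cases h.take (h.length - (a + 1)) with
        | nil => simpa using hρ
        | cons x l => rfl
      rw [hcur]
      exact hf₁ _
    · exact hf₁ h
  have hearly : ∀ (y : ℕ → V) (t : ℕ), (t < a ∨ hist y a ≠ hist ρ a) →
      f' (hist y t) = f₁ (hist y t) := by
    intro y t ht
    refine if_neg fun H => ?_
    simp only [length_hist, Nat.add_sub_add_right] at H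
    rcases lt_or_ge t a with hta | hta
    · have := congrArg List.length H
      simp at this
      omega
    · rw [drop_hist y hta] at H
      exact ht.elim (fun h => by omega) fun h => h H
  have hlate : ∀ (y : ℕ → V) (t : ℕ), (∀ s ≤ a, y s = ρ s) → a ≤ t →
      f' (hist y t) = f₁ (hist (splice ρ (a + d) d y) (t + d)) := by
    intro y t hy ht
    have H : (hist y t).drop ((hist y t).length - (a + 1)) = hist ρ a := by
      simpa [drop_hist y ht] using hist_congr hy
    dsimp only [f']
    rw [if_pos H, ← hist_splice hρ hy ht]
    simp
  set ρ' := G.run v₀ f' with hρ'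
  have hsucc : ∀ t, ρ (t + 1) = f₁ (hist ρ t) := fun t => by
    rw [← hrun]; exact G.run_succ v₀ f₁ t
  have hag : ∀ t ≤ a, ρ' t = ρ t := by
    intro t
    induction t using Nat.strong_induction_on with
    | _ t ih =>
      intro ht
      cases t with
      | zero => rfl
      | succ t =>
        rw [hρ', run_succ, ← hρ', hearly ρ' t (.inl (by omega)), hsucc,
          hist_congr fun s hs => ih s (by omega) (by omega)]
  have hsplice : splice ρ (a + d) d ρ' = ρ := by
    refine Eq.trans (run_unique (G := G) (v₀ := v₀) (f := f₁) rfl fun t => ?_).symm hrun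
    rcases lt_or_ge t (a + d) with ht | ht
    · rw [splice_of_le (by omega), hsucc,
        hist_congr (z := splice ρ (a + d) d ρ') fun s hs => (splice_of_le (by omega)).symm]
    · obtain ⟨s, rfl⟩ : ∃ s, t = s + d := ⟨t - d, by omega⟩
      rw [show s + d + 1 = s + 1 + d by omega, splice_add hρ hag (by omega), hρ', run_succ, ← hρ',
        hlate ρ' s hag (by omega)]
  have hx' : ∀ i, G.cost i ρ ≤ a ∨ ((a + d : ℕ) : ℕ∞) < G.cost i ρ := fun i =>
    (hx i).imp_right fun h => lt_of_lt_of_le (by exact_mod_cast (by omega)) h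
  have hcost : ∀ y : ℕ → V, (∀ s ≤ a, y s = ρ s) → ∀ i,
      G.cost i (splice ρ (a + d) d y) = shiftAfter a d (G.cost i y) := fun y hy i =>
    cost_splice G hρ hy (hx' i)
  have hcost' : ∀ i, G.cost i ρ = shiftAfter a d (G.cost i ρ') := fun i => by
    rw [← hcost ρ' hag i, hsplice]
  refine ⟨f', hlegal, fun j y hy hp => ?_, hcost'⟩
  by_cases hya : hist y a = hist ρ a
  · have hya := eq_of_hist_eq hya
    refine hs₁ j (splice ρ (a + d) d y) ⟨?_, fun t => ?_, fun t ht => ?_⟩ ?_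
    · exact splice_of_le (Nat.zero_le _)
    · rcases lt_or_ge t (a + d) with ht | ht
      · rw [splice_of_le ht.le, splice_of_le ht]
        exact (hf.isDev_run j).edge t
      · obtain ⟨s, rfl⟩ : ∃ s, t = s + d := ⟨t - d, by omega⟩
        rw [show s + d + 1 = s + 1 + d by omega, splice_add hρ hya (by omega),
          splice_add hρ hya (by omega)]
        exact hy.edge s
    · rcases lt_or_ge t (a + d) with hta | hta
      · rw [splice_of_le hta, hsucc,
          hist_congr (z := splice ρ (a + d) d y) fun s hs => (splice_of_le (by omega)).symm]
      · obtain ⟨s, rfl⟩ : ∃ s, t = s + d := ⟨t - d, by omega⟩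
        rw [splice_add hρ hya (by omega)] at ht
        rw [show s + d + 1 = s + 1 + d by omega, splice_add hρ hya (by omega), hy.follow s ht,
          hlate y s hya (by omega)]
    · rw [hrun]
      simp only [hcost', hcost y hya]
      exact (prec_comp_iff (shiftAfter_strictMono a d)).2 hp
  · have hy₁ : G.IsDev v₀ f₁ j y :=
      ⟨hy.zero, hy.edge, fun t ht => by rw [hy.follow t ht, hearly y t (.inr hya)]⟩
    have hge : G.cost j ρ ≤ G.cost j y := not_lt.1 fun h => by
      refine hs₁ j y hy₁ (.inl ?_)
      rwa [hrun]
    have hcases : ∀ i, G.cost i ρ = G.cost i ρ' ∨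
        ((a + Fintype.card V : ℕ) : ℕ∞) ≤ G.cost i ρ' := fun i => by
      by_cases h : G.cost i ρ' ≤ a
      · exact .inl (by rw [hcost', shiftAfter, if_pos h])
      · right
        have h1 := hcost' i
        rw [shiftAfter, if_neg h] at h1
        have h2 := (hx i).resolve_left fun h3 => h (le_self_add.trans (h1 ▸ h3))
        rw [h1, show a + d + Fintype.card V = a + Fintype.card V + d by omega,
          Nat.cast_add _ d] at h2
        exact (ENat.add_le_add_iff_right (ENat.natCast_ne_top d)).1 h2
    have hle : ∀ i, G.cost i ρ' ≤ G.cost i ρ := fun i => by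
      rw [hcost', shiftAfter]
      split_ifs
      · exact le_rfl
      · exact le_self_add
    have heq : G.cost j ρ' = G.cost j y ∧ ∀ i, G.cost i ρ' ≤ G.cost i y :=
      hp.elim (fun h => (h.not_ge ((hle j).trans hge)).elim) fun h => ⟨h.1, h.2.1⟩
    have hρj : G.cost j ρ = G.cost j ρ' := le_antisymm (heq.1 ▸ hge) (hle j)
    have hxj : G.cost j ρ ≤ a ∨ G.cost j ρ = ⊤ := by
      have h := hcost' j
      rw [shiftAfter] at h
      by_contra! hcon
      rw [hρj] at hcon h
      rw [if_neg hcon.1.not_ge] at h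
      obtain ⟨k, hk⟩ := ENat.ne_top_iff_exists.1 hcon.2
      rw [← hk] at h
      norm_cast at h
      omega
    rcases hfast j y hy₁ hya hxj with ⟨i, hi, hi'⟩ | h | ⟨-, h⟩
    · refine (heq.2 i).not_gt ?_
      rcases hcases i with h | h
      · exact h ▸ hi
      · exact hi'.trans_le h
    · exact h.ne (hρj.trans heq.1)
    · obtain ⟨i, hi, hi'⟩ := hfin
      exact (h i).elim hi hi'

end Cut

section DevOptimal

variable [Fintype V] {G : QRGame ι V} {v₀ : V} {f : List V → V}

/-- If all goal sets visited by the outcome are visited by time `M`, then the outcome is that of a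
stable map from which no deviation is profitable on prefixes of length `M + |V|`. -/
lemma exists_dev_optimal (hf : G.IsLegal v₀ f) (hs : G.IsStable v₀ f) {M : ℕ}
    (hM : ∀ i, G.cost i (G.run v₀ f) ≤ M ∨ G.cost i (G.run v₀ f) = ⊤) :
    ∃ f', G.IsLegal v₀ f' ∧ G.run v₀ f' = G.run v₀ f ∧ G.IsStable v₀ f' ∧
      ∀ j y, G.IsDev v₀ f' j y →
        ¬ Prec j (fun i => G.costLT i (G.run v₀ f) (M + Fintype.card V))
          fun i => G.costLT i y (M + Fintype.card V) := by
  obtain ⟨f', hf', hrun, hs', hfast⟩ := exists_fast_punishment hf hs (a := M) fun i =>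
    (hM i).imp_right fun h => h ▸ le_top
  refine ⟨f', hf', hrun, hs', fun j y hy hp => ?_⟩
  set ρ := G.run v₀ f
  have hn : 0 < Fintype.card V := Fintype.card_pos_iff.2 ⟨v₀⟩
  set D := M + Fintype.card V
  have hρ : ∀ i, G.costLT i ρ D = G.cost i ρ := fun i => by
    rw [costLT_eq]
    split_ifs with h
    · rfl
    · refine ((hM i).resolve_left fun h' => h (h'.trans_lt ?_)).symm
      exact_mod_cast (by omega : M < D)
  have hy' : ∀ i, G.cost i y ≤ G.costLT i y D := fun i => by
    rw [costLT_eq]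
    split_ifs
    · exact le_rfl
    · exact le_top
  have hge : G.cost j ρ ≤ G.cost j y := not_lt.1 fun h => by
    refine hs' j y hy (.inl ?_)
    rwa [hrun]
  simp only [hρ, Prec] at hp
  obtain ⟨heq, hle, i₀, hi₀⟩ := hp.resolve_left fun h => h.not_ge (hge.trans (hy' j))
  have hsame : ∀ i, G.cost i ρ ≤ M → G.cost i y = G.cost i ρ → G.costLT i y D = G.cost i ρ := by
    intro i hi h
    rw [costLT_eq, h, if_pos (hi.trans_lt _)]
    exact_mod_cast (by omega : M < D)
  have hi₀M : G.cost i₀ ρ ≤ M := (hM i₀).resolve_right hi₀.ne_top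
  by_cases hyM : hist y M = hist ρ M
  · exact hi₀.ne' (hsame i₀ hi₀M
      (G.cost_eq_of_agree (fun s hs => (eq_of_hist_eq hyM s hs).symm) hi₀M))
  · rcases hfast j y hy hyM (hM j) with ⟨i, hi, hi'⟩ | h | ⟨h, -⟩
    · refine (hle i).not_gt ?_
      rwa [costLT_eq, if_pos hi']
    · exact (h.trans_le (hy' j)).ne heq
    · exact hi₀.ne' (hsame i₀ hi₀M (h i₀ hi₀M))

end DevOptimal

section GoalOptimal

variable [Fintype ι] [Fintype V] {G : QRGame ι V} {v₀ : V} {f : List V → V}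

lemma exists_free_block {x : ι → ℕ∞} {m : ℕ} {i₀ : ι}
    (h : ((m * Fintype.card ι : ℕ) : ℕ∞) ≤ x i₀) :
    ∃ t < Fintype.card ι, ∀ i, x i < (m * t : ℕ) ∨ ((m * t + m : ℕ) : ℕ∞) ≤ x i := by
  by_contra! hcon
  choose φ hφ using fun t : Fin (Fintype.card ι) => hcon t t.2
  have hlt : ∀ s t : Fin (Fintype.card ι), φ s = φ t → ¬ s < t := fun s t hst hlt => by
    have h1 := (hφ t).1.trans_lt (hst ▸ (hφ s).2)
    have h2 : m * (s + 1 : ℕ) ≤ m * t := Nat.mul_le_mul_left m hlt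
    norm_cast at h1
    rw [mul_add, mul_one] at h2
    omega
  have hinj : Function.Injective φ := fun s t hst => by
    have h1 := hlt s t hst
    have h2 := hlt t s hst.symm
    exact le_antisymm (not_lt.1 h2) (not_lt.1 h1)
  obtain ⟨t, rfl⟩ := ((Fintype.bijective_iff_injective_and_card φ).2 ⟨hinj, by simp⟩).2 i₀
  have h1 := h.trans_lt (hφ t).2
  have h2 : m * (t + 1 : ℕ) ≤ m * Fintype.card ι := Nat.mul_le_mul_left m t.2
  norm_cast at h1
  rw [mul_add, mul_one] at h2
  omega

lemma exists_goal_optimal (hf : G.IsLegal v₀ f) (hs : G.IsStable v₀ f) :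
    ∃ f', G.IsLegal v₀ f' ∧ G.IsStable v₀ f' ∧ ∀ i, G.cost i (G.run v₀ f') ≠ ⊤ →
      G.cost i (G.run v₀ f') < ((2 * Fintype.card ι * Fintype.card V : ℕ) : ℕ∞) := by
  induction hm : ∑ i, (G.cost i (G.run v₀ f)).toNat using Nat.strong_induction_on
    generalizing f with
  | _ m ih =>
    by_contra! hcon
    obtain ⟨i₀, htop, hi₀⟩ := hcon f hf hs
    set ρ := G.run v₀ f
    set n := Fintype.card V with hn
    rw [mul_right_comm] at hi₀
    obtain ⟨t, ht, hblock⟩ := exists_free_block (x := fun i => G.cost i ρ) hi₀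
    obtain ⟨a, d, hd, hat, hdt, hρ⟩ : ∃ a d, 0 < d ∧ 2 * n * t ≤ a ∧ a + d ≤ 2 * n * t + n ∧
        ρ a = ρ (a + d) := by
      obtain ⟨r, s, hrs, heq⟩ := Fintype.exists_ne_map_eq_of_card_lt
        (fun s : Fin (n + 1) => ρ (2 * n * t + s)) (by simp [hn])
      wlog hlt : r < s generalizing r s
      · exact this s r hrs.symm heq.symm (lt_of_le_of_ne (not_lt.1 hlt) hrs.symm)
      have : (r : ℕ) < s := hlt
      refine ⟨2 * n * t + r, s - r, by omega, by omega, by omega, ?_⟩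
      rwa [show 2 * n * t + r + (s - r) = 2 * n * t + s by omega]
    have hx : ∀ i, G.cost i ρ ≤ a ∨ ((a + d + n : ℕ) : ℕ∞) ≤ G.cost i ρ := fun i =>
      (hblock i).imp (fun h => h.le.trans (by exact_mod_cast hat))
        fun h => le_trans (by exact_mod_cast (by omega)) h
    have hi₀a : ¬ G.cost i₀ ρ ≤ a := fun h => by
      have h1 := hi₀.trans h
      have h2 : 2 * n * (t + 1) ≤ 2 * n * Fintype.card ι := Nat.mul_le_mul_left _ ht
      have h3 : 0 < n := Fintype.card_pos_iff.2 ⟨v₀⟩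
      norm_cast at h1
      rw [mul_add] at h2
      omega
    obtain ⟨f', hf', hs', hcost⟩ := exists_cut hf hs hd hρ hx ⟨i₀, hi₀a, htop⟩
    have hle : ∀ c : ℕ∞, c.toNat ≤ (shiftAfter a d c).toNat ∧
        (shiftAfter a d c ≠ ⊤ → ¬ shiftAfter a d c ≤ a → c.toNat < (shiftAfter a d c).toNat) := by
      intro c
      unfold shiftAfter
      induction c using ENat.recTopCoe with
      | top => simp
      | coe c =>
        split_ifs with h
        · exact ⟨le_rfl, fun _ h' => (h' h).elim⟩
        · rw [← Nat.cast_add]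
          simp only [ENat.toNat_natCast]
          exact ⟨by omega, fun _ _ => by omega⟩
    obtain ⟨f'', h1, h2, h3⟩ := ih _ (hm ▸ Finset.sum_lt_sum
      (fun i _ => by rw [hcost i]; exact (hle _).1)
      ⟨i₀, Finset.mem_univ _, by rw [hcost i₀] at htop hi₀a ⊢; exact (hle _).2 htop hi₀a⟩)
      hf' hs' rfl
    obtain ⟨i, hi, hi'⟩ := hcon f'' h1 h2
    exact (h3 i hi).not_ge hi'

end GoalOptimal

end QRGame

/-- If there exists a secure equilibrium in a multiplayer quantitative
reachability game `(G, v₀)`, then there exists one in `(G, v₀)` which is both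
goal-optimal (with bound `Γ = 2·|Π|·|V|`) and dev-optimal. -/
theorem exists_goal_and_dev_optimal_secure_equilibrium
    {ι V : Type} [Fintype ι] [Fintype V] [DecidableEq ι]
    (G : QRGame ι V) (v₀ : V) (Γ : ℕ)
    (hΓ : Γ = 2 * Fintype.card ι * Fintype.card V)
    (hex : ∃ σ : ι → List V → V, G.IsProfile v₀ σ ∧ G.IsSecure v₀ σ) :
    ∃ τ : ι → List V → V, G.IsProfile v₀ τ ∧ G.IsSecure v₀ τ ∧
      G.GoalOpt v₀ τ Γ ∧ G.DevOpt v₀ τ := by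
  obtain ⟨σ, hσ, hsec⟩ := hex
  obtain ⟨f₀, hf₀, hs₀⟩ := hsec.exists_isStable hσ
  obtain ⟨f, hf, hs, hgoal⟩ := QRGame.exists_goal_optimal hf₀ hs₀
  rw [← hΓ] at hgoal
  set M := (⨆ i ∈ {i : ι | G.cost i (G.run v₀ f) ≠ ⊤}, G.cost i (G.run v₀ f)).toNat with hMdef
  have hM : ∀ i, G.cost i (G.run v₀ f) ≤ M ∨ G.cost i (G.run v₀ f) = ⊤ := fun i => by
    rw [or_iff_not_imp_right]
    intro hi
    rw [hMdef, ENat.natCast_toNat]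
    · exact le_iSup₂ (f := fun i (_ : i ∈ {i : ι | G.cost i (G.run v₀ f) ≠ ⊤}) =>
        G.cost i (G.run v₀ f)) i hi
    · exact ne_top_of_le_ne_top (ENat.natCast_ne_top Γ) (iSup₂_le fun i hi => (hgoal i hi).le)
  obtain ⟨f', hf', hrun, hs', hdev⟩ := QRGame.exists_dev_optimal hf hs hM
  refine ⟨fun _ => f', hf'.isProfile, ?_, ?_, ?_⟩
  · rintro ⟨j, σ', hσ', hp⟩
    exact hs' j _ (hf'.isDev_outcome_update hσ') hp
  · intro i
    change G.cost i (G.run v₀ f') ≠ ⊤ → G.cost i (G.run v₀ f') < Γ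
    rw [hrun]
    exact hgoal i
  · intro j σ' hσ'
    have hD : G.devBound (G.outcome v₀ fun _ => f') = M + Fintype.card V := by
      change G.devBound (G.run v₀ f') = _
      rw [hrun]
      rfl
    rw [hD]
    change ¬ Prec j (fun i => G.costLT i (G.run v₀ f') _) _
    rw [hrun]
    exact hdev j _ (hf'.isDev_outcome_update hσ')
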